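/- Let m be a square-free positive integer with m ≡ 2 or 3 (mod 4), let θ = m^(1/4) be the real positive fourth root of m, and let K = ℚ(i, θ). Then the discriminant of the ℚ-basis {1, θ, θ², θ³, i, iθ, iθ², iθ³} of K (i.e., the discriminant of this 8-tuple of algebraic integers of K) equals 2^24 · m^6. -/

import Mathlib

open NumberField

/-- The real positive fourth root of `m`, viewed as a complex number. -/
noncomputable def theta (m : ℕ) : ℂ := ((m : ℝ) ^ ((1 : ℝ) / 4) : ℝ)

/-- The octic field `K = ℚ(i, m^(1/4))` as a subfield of `ℂ`. -/
noncomputable def Kfield (m : ℕ) : IntermediateField ℚ ℂ :=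
  IntermediateField.adjoin ℚ {Complex.I, theta m}

theorem theta_pow_four (m : ℕ) : theta m ^ 4 = (m : ℂ) := by
  have h : ((m : ℝ) ^ ((1 : ℝ) / 4)) ^ 4 = (m : ℝ) := by
    rw [← Real.rpow_natCast, ← Real.rpow_mul (by positivity)]
    norm_num
  unfold theta
  exact_mod_cast h

open Polynomial in
theorem irreducible_X_pow_four_sub {m : ℕ} (hm : Squarefree m) (h1 : m ≠ 1) :
    Irreducible (X ^ 4 - C (m : ℚ)) := by
  obtain ⟨p, hp, hpm⟩ := Nat.exists_prime_and_dvd h1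
  have hmonic : (X ^ 4 - C (m : ℤ)).Monic := monic_X_pow_sub_C _ (by norm_num)
  have hdeg : (X ^ 4 - C (m : ℤ)).natDegree = 4 := natDegree_X_pow_sub_C
  have hpZ : Prime (p : ℤ) := Nat.prime_iff_prime_int.mp hp
  have heis : (X ^ 4 - C (m : ℤ)).IsEisensteinAt (Ideal.span {(p : ℤ)}) := by
    refine hmonic.isEisensteinAt_of_mem_of_notMem ?_ ?_ ?_
    · rw [Ne, Ideal.span_singleton_eq_top]
      exact hpZ.not_isUnit
    · intro n hn
      rw [hdeg] at hn
      rw [Ideal.mem_span_singleton, coeff_sub, coeff_X_pow, coeff_C, if_neg hn.ne]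
      split_ifs
      · simpa using Int.natCast_dvd_natCast.mpr hpm
      · simp
    · rw [Ideal.span_singleton_pow, Ideal.mem_span_singleton]
      intro h
      have h' : p * p ∣ m := by
        have : ((p * p : ℕ) : ℤ) ∣ (m : ℤ) := by simpa [sq] using h
        exact_mod_cast this
      exact hp.not_isUnit (hm p h')
  have hirr := heis.irreducible ((Ideal.span_singleton_prime hpZ.ne_zero).mpr hpZ)
    hmonic.isPrimitive (by rw [hdeg]; norm_num)
  have := (hmonic.irreducible_iff_irreducible_map_fraction_map (K := ℚ)).mp hirr
  simpa using this

open Polynomial in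
theorem minpoly_theta {m : ℕ} (hm : Squarefree m) (h1 : m ≠ 1) :
    minpoly ℚ (theta m) = X ^ 4 - C (m : ℚ) :=
  (minpoly.eq_of_irreducible_of_monic (irreducible_X_pow_four_sub hm h1)
    (by simp [theta_pow_four]) (monic_X_pow_sub_C _ (by norm_num))).symm

theorem linearIndependent_theta_pow {m : ℕ} (hm : Squarefree m) (h1 : m ≠ 1) :
    LinearIndependent ℚ (fun i : Fin 4 => theta m ^ (i : ℕ)) := by
  have h := linearIndependent_pow (K := ℚ) (theta m)
  have hd : (minpoly ℚ (theta m)).natDegree = 4 := by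
    rw [minpoly_theta hm h1, Polynomial.natDegree_X_pow_sub_C]
  rw [hd] at h
  exact h

theorem finrank_Kfield_le (m : ℕ) : Module.finrank ℚ (Kfield m) ≤ 8 := by
  have hI : IsIntegral ℚ Complex.I :=
    ⟨Polynomial.X ^ 2 - Polynomial.C (-1), Polynomial.monic_X_pow_sub_C _ (by norm_num), by simp⟩
  have hθ : IsIntegral ℚ (theta m) :=
    ⟨Polynomial.X ^ 4 - Polynomial.C (m : ℚ), Polynomial.monic_X_pow_sub_C _ (by norm_num),
      by simp [theta_pow_four]⟩
  have key : Kfield m =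
      IntermediateField.adjoin ℚ {Complex.I} ⊔ IntermediateField.adjoin ℚ {theta m} := by
    rw [← IntermediateField.adjoin_union]; rfl
  have hIdeg : Module.finrank ℚ (IntermediateField.adjoin ℚ {Complex.I}) ≤ 2 := by
    rw [IntermediateField.adjoin.finrank hI]
    refine (Polynomial.natDegree_le_of_dvd (minpoly.dvd ℚ Complex.I
      (p := Polynomial.X ^ 2 - Polynomial.C (-1)) (by simp))
      (Polynomial.monic_X_pow_sub_C _ (by norm_num)).ne_zero).trans ?_
    rw [Polynomial.natDegree_X_pow_sub_C]
  have hθdeg : Module.finrank ℚ (IntermediateField.adjoin ℚ {theta m}) ≤ 4 := by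
    rw [IntermediateField.adjoin.finrank hθ]
    refine (Polynomial.natDegree_le_of_dvd (minpoly.dvd ℚ (theta m)
      (p := Polynomial.X ^ 4 - Polynomial.C (m : ℚ)) (by simp [theta_pow_four]))
      (Polynomial.monic_X_pow_sub_C _ (by norm_num)).ne_zero).trans ?_
    rw [Polynomial.natDegree_X_pow_sub_C]
  rw [key]
  exact (IntermediateField.finrank_sup_le _ _).trans (Nat.mul_le_mul hIdeg hθdeg)

instance finiteDimensional_Kfield (m : ℕ) : FiniteDimensional ℚ (Kfield m) := by
  refine IntermediateField.finiteDimensional_adjoin fun x hx => ?_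
  rcases hx with rfl | rfl
  · exact ⟨Polynomial.X ^ 2 - Polynomial.C (-1),
      Polynomial.monic_X_pow_sub_C _ (by norm_num), by simp⟩
  · exact ⟨Polynomial.X ^ 4 - Polynomial.C (m : ℚ),
      Polynomial.monic_X_pow_sub_C _ (by norm_num), by simp [theta_pow_four]⟩

theorem coe_rat_smul {m : ℕ} (q : ℚ) (x : Kfield m) :
    ((q • x : Kfield m) : ℂ) = (q : ℂ) * (x : ℂ) := by
  rw [IntermediateField.coe_smul, Algebra.smul_def]
  simp

theorem linearIndependent_of_coe_eq {m : ℕ} (hm : Squarefree m) (h1 : m ≠ 1)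
    {b : Fin 8 → Kfield m}
    (hb : ∀ j : Fin 8, ((b j : ℂ)) =
      ![1, theta m, (theta m) ^ 2, (theta m) ^ 3, Complex.I,
        Complex.I * theta m, Complex.I * (theta m) ^ 2, Complex.I * (theta m) ^ 3] j) :
    LinearIndependent ℚ b := by
  rw [Fintype.linearIndependent_iff]
  intro g hg
  have hli := Fintype.linearIndependent_iff.mp (linearIndependent_theta_pow hm h1)
  have hsum := congrArg (Kfield m).val hg
  rw [map_sum, map_zero] at hsum
  simp only [IntermediateField.coe_val, coe_rat_smul, hb,
    Fin.sum_univ_eight] at hsum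
  set t : ℝ := (m : ℝ) ^ ((1 : ℝ) / 4)
  have hth : theta m = (t : ℂ) := rfl
  simp [hth] at hsum
  have hre : (g 0 : ℝ) + g 1 * t + g 2 * t ^ 2 + g 3 * t ^ 3 = 0 := by
    have := congrArg Complex.re hsum
    simpa [← Complex.ofReal_pow] using this
  have him : (g 4 : ℝ) + g 5 * t + g 6 * t ^ 2 + g 7 * t ^ 3 = 0 := by
    have := congrArg Complex.im hsum
    simpa [← Complex.ofReal_pow] using this
  have h0 := hli ![g 0, g 1, g 2, g 3] (by
    simp [Fin.sum_univ_four, hth, Algebra.smul_def]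
    exact_mod_cast hre)
  have h4 := hli ![g 4, g 5, g 6, g 7] (by
    simp [Fin.sum_univ_four, hth, Algebra.smul_def]
    exact_mod_cast him)
  simp [Fin.forall_fin_succ] at h0 h4 ⊢
  tauto

/-- The index of the basis element proportional to the product of basis elements `i` and `j`. -/
def mulIndex (i j : Fin 8) : Fin 8 :=
  ⟨(i.val + j.val) % 4 + 4 * ((i.val / 4 + j.val / 4) % 2), by omega⟩

/-- The scalar relating the product of basis elements `i` and `j` to a basis element. -/
def mulCoeff (m : ℕ) (i j : Fin 8) : ℚ :=
  (if 4 ≤ i.val % 4 + j.val % 4 then (m : ℚ) else 1) * (if 4 ≤ i.val ∧ 4 ≤ j.val then -1 else 1)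

theorem mul_eq_mulCoeff_smul {m : ℕ} {b : Fin 8 → Kfield m}
    (hb : ∀ j : Fin 8, ((b j : ℂ)) =
      ![1, theta m, (theta m) ^ 2, (theta m) ^ 3, Complex.I,
        Complex.I * theta m, Complex.I * (theta m) ^ 2, Complex.I * (theta m) ^ 3] j)
    (i j : Fin 8) : b i * b j = mulCoeff m i j • b (mulIndex i j) := by
  apply Subtype.ext
  have h4 := theta_pow_four m
  have hI := Complex.I_sq
  rw [coe_rat_smul, MulMemClass.coe_mul, hb, hb, hb]
  generalize theta m = t at h4
  generalize Complex.I = I at hI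
  fin_cases i <;> fin_cases j <;> simp [mulCoeff, mulIndex] <;> grind

theorem trace_basis_eq {m : ℕ} (B : Module.Basis (Fin 8) ℚ (Kfield m))
    (hB : ∀ i j, B i * B j = mulCoeff m i j • B (mulIndex i j)) (k : Fin 8) :
    Algebra.trace ℚ (Kfield m) (B k) = if k = 0 then 8 else 0 := by
  rw [Algebra.trace_eq_matrix_trace B, Matrix.trace]
  simp only [Matrix.diag_apply, Algebra.leftMulMatrix_eq_repr_mul, hB, map_smul,
    Module.Basis.repr_self, Finsupp.smul_apply, smul_eq_mul, Finsupp.single_apply]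
  have hidx : ∀ j, mulIndex k j = j ↔ k = 0 := by
    revert k; decide
  simp only [hidx]
  split_ifs with h
  · subst h
    have : ∀ j, mulCoeff m 0 j = 1 := by
      intro j
      simp [mulCoeff]
      omega
    simp [this]
  · simp

/-- For squarefree `m ≡ 2, 3 (mod 4)`, the discriminant of the basis
`{1, θ, θ², θ³, i, iθ, iθ², iθ³}` of `ℚ(i, m^(1/4))` equals `2^24 m^6`. -/
theorem stmt_7 (m : ℕ) (hm : Squarefree m) (hpos : 0 < m)
    (h23 : m % 4 = 2 ∨ m % 4 = 3) (b : Fin 8 → Kfield m)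
    (hb : ∀ j : Fin 8, ((b j : ℂ)) =
      ![1, theta m, (theta m) ^ 2, (theta m) ^ 3, Complex.I,
        Complex.I * theta m, Complex.I * (theta m) ^ 2, Complex.I * (theta m) ^ 3] j) :
    Algebra.discr ℚ b = 2 ^ 24 * (m : ℚ) ^ 6 := by
  have h1 : m ≠ 1 := by omega
  have hli := linearIndependent_of_coe_eq hm h1 hb
  have hcard : Fintype.card (Fin 8) = Module.finrank ℚ (Kfield m) :=
    le_antisymm hli.fintype_card_le_finrank (by simpa using finrank_Kfield_le m)
  have hB : ⇑(basisOfLinearIndependentOfCardEqFinrank hli hcard) = b :=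
    coe_basisOfLinearIndependentOfCardEqFinrank hli hcard
  have htr : ∀ k, Algebra.trace ℚ (Kfield m) (b k) = if k = 0 then 8 else 0 := by
    have := trace_basis_eq (basisOfLinearIndependentOfCardEqFinrank hli hcard)
    rw [hB] at this
    exact this (mul_eq_mulCoeff_smul hb)
  have hmat : Algebra.traceMatrix ℚ b =
      (Matrix.diagonal fun i : Fin 8 =>
        (![(8 : ℚ), 8 * m, 8 * m, 8 * m, -8, -(8 * m), -(8 * m), -(8 * m)] : Fin 8 → ℚ) i).submatrix
        (Equiv.swap (1 : Fin 8) 3 * Equiv.swap 5 7 : Equiv.Perm (Fin 8)) id := by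
    ext i j
    rw [Algebra.traceMatrix_apply, Algebra.traceForm_apply, mul_eq_mulCoeff_smul hb, map_smul, htr,
      Matrix.submatrix_apply, Matrix.diagonal_apply]
    have hidx : ∀ i j : Fin 8, mulIndex i j = 0 ↔
        (Equiv.swap (1 : Fin 8) 3 * Equiv.swap 5 7 : Equiv.Perm (Fin 8)) i = id j := by
      decide
    simp only [hidx]
    split_ifs with h
    · rw [h]
      have hij : i = (Equiv.swap (1 : Fin 8) 3 * Equiv.swap 5 7 : Equiv.Perm (Fin 8)) j := by
        revert i j; decide
      subst hij
      fin_cases j <;> simp [mulCoeff, Equiv.swap_apply_def, mul_comm]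
    · simp
  have hsign : Equiv.Perm.sign (Equiv.swap (1 : Fin 8) 3 * Equiv.swap 5 7) = 1 := by decide
  rw [Algebra.discr_def, hmat, Matrix.det_permute, hsign, Matrix.det_diagonal]
  simp [Fin.prod_univ_eight]
  ring
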